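/- Let 1 < p < ∞, Θ ∈ (−1, ∞), θ ∈ (−2, ∞), and let γ, ν ∈ ℝ satisfy −(1+Θ) < γ < (1+Θ)(p−1) and −(2+θ) < ν < (2+θ)(p−1). Then there exists a finite constant C such that for every x ∈ 𝒟 and every r > 0, writing B = B(x, r) and μ(E) = w_{Θ,θ}(E), one has ( μ(B)^{−1} ∫_B w_{γ,ν}(y) w_{Θ,θ}(y) dy ) · ( μ(B)^{−1} ∫_B w_{γ,ν}(y)^{−1/(p−1)} w_{Θ,θ}(y) dy )^{p−1} ≤ C; that is, w_{γ,ν} is a Muckenhoupt A_p-weight with respect to the measure with density w_{Θ,θ} on 𝒟. -/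

import Mathlib

open MeasureTheory Set Real
open scoped ENNReal

noncomputable section

abbrev E2 := EuclideanSpace ℝ (Fin 2)

/-- The planar angular domain with opening angle `κ`. -/
def Dset (κ : ℝ) : Set E2 :=
  {x | ∃ r φ : ℝ, 0 < r ∧ 0 < φ ∧ φ < κ ∧ x 0 = r * Real.cos φ ∧ x 1 = r * Real.sin φ}

/-- `B(x, r)`: the part of the Euclidean ball of radius `r` around `x` lying in `𝒟`. -/
def ballD (κ : ℝ) (x : E2) (r : ℝ) : Set E2 :=
  {y | y ∈ Dset κ ∧ dist y x < r}

/-- Geodesic (arc-length) distance between unit vectors of `S¹ ⊆ ℝ²`. -/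
def dS1 (u v : E2) : ℝ := Real.arccos (inner ℝ u v)

/-- The "windshield wiper" set `S(x, r)`; for `x = 0` the angular condition is vacuous
(convention `a/0 = ∞`). -/
def Sset (κ : ℝ) (x : E2) (r : ℝ) : Set E2 :=
  {y | y ∈ Dset κ ∧ |‖y‖ - ‖x‖| < r ∧ (x ≠ 0 → dS1 (‖x‖⁻¹ • x) (‖y‖⁻¹ • y) < r / ‖x‖)}

/-- Distance from `x` to the boundary of `𝒟`. -/
def rhoD (κ : ℝ) (x : E2) : ℝ := Metric.infDist x (frontier (Dset κ))

/-- The mixed power weight `w_{γ,ν}(x) = ρ_∘(x)^{ν-γ} ρ_𝒟(x)^γ`. -/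
def wgt (κ γ ν : ℝ) (x : E2) : ℝ := ‖x‖ ^ (ν - γ) * rhoD κ x ^ γ

/-- `w_{γ,ν}(E) = ∫_E w_{γ,ν} dx`, valued in `[0,∞]`. -/
def wMeas (κ γ ν : ℝ) (E : Set E2) : ℝ≥0∞ :=
  ∫⁻ x in E, ENNReal.ofReal (wgt κ γ ν x)

/-! ### Geometry of sectors -/

/-- The open sector of directions with angle in `(A, B)`. -/
def sector (A B : ℝ) : Set E2 :=
  {x | ∃ r φ : ℝ, 0 < r ∧ A < φ ∧ φ < B ∧ x 0 = r * Real.cos φ ∧ x 1 = r * Real.sin φ}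

/-- The unit normal to the ray of angle `α`. -/
def rayNormal (α : ℝ) : E2 := !₂[-Real.sin α, Real.cos α]

lemma inner_rayNormal (α : ℝ) (y : E2) :
    inner ℝ (rayNormal α) y = Real.cos α * y 1 - Real.sin α * y 0 := by
  simp [rayNormal, PiLp.inner_apply, Fin.sum_univ_two]
  ring

lemma norm_rayNormal (α : ℝ) : ‖rayNormal α‖ = 1 := by
  simp [rayNormal, EuclideanSpace.norm_eq, Fin.sum_univ_two]

lemma abs_inner_rayNormal_le (α : ℝ) (y : E2) : |inner ℝ (rayNormal α) y| ≤ ‖y‖ := by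
  simpa [norm_rayNormal] using abs_real_inner_le_norm (rayNormal α) y

lemma inner_rayNormal_polar {α r φ : ℝ} {y : E2} (h0 : y 0 = r * Real.cos φ)
    (h1 : y 1 = r * Real.sin φ) : inner ℝ (rayNormal α) y = r * Real.sin (φ - α) := by
  rw [inner_rayNormal, h0, h1, Real.sin_sub]
  ring

lemma norm_polar {r φ : ℝ} (hr : 0 ≤ r) {y : E2} (h0 : y 0 = r * Real.cos φ)
    (h1 : y 1 = r * Real.sin φ) : ‖y‖ = r := by
  rw [EuclideanSpace.norm_eq, Fin.sum_univ_two, h0, h1]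
  have : ‖r * Real.cos φ‖ ^ 2 + ‖r * Real.sin φ‖ ^ 2 = r ^ 2 := by
    simp only [Real.norm_eq_abs, sq_abs]
    linear_combination r ^ 2 * Real.sin_sq_add_cos_sq φ
  rw [this, Real.sqrt_sq hr]

lemma exists_polar (A : ℝ) (y : E2) :
    ∃ r ω : ℝ, 0 ≤ r ∧ A ≤ ω ∧ ω < A + 2 * π ∧ y 0 = r * Real.cos ω ∧ y 1 = r * Real.sin ω := by
  obtain ⟨m, ⟨hm1, hm2⟩, -⟩ :=
    existsUnique_add_zsmul_mem_Ico Real.two_pi_pos (Complex.arg ⟨y 0, y 1⟩) A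
  refine ⟨‖(⟨y 0, y 1⟩ : ℂ)‖, _, norm_nonneg _, hm1, hm2, ?_, ?_⟩
  · rw [zsmul_eq_mul, Real.cos_add_int_mul_two_pi, Complex.norm_mul_cos_arg]
  · rw [zsmul_eq_mul, Real.sin_add_int_mul_two_pi, Complex.norm_mul_sin_arg]

lemma mem_sector_of_inner {A B α β : ℝ} (hA : A ≤ α) (hB : β ≤ B) (hαβ : α ≤ β) {y : E2}
    (h1 : 0 < inner ℝ (rayNormal α) y) (h2 : inner ℝ (rayNormal β) y < 0) : y ∈ sector A B := by
  obtain ⟨r, ω, hr, hω1, hω2, hy0, hy1⟩ := exists_polar α y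
  rw [inner_rayNormal_polar hy0 hy1] at h1 h2
  have hr0 : 0 < r := by
    rcases hr.eq_or_lt with h | h
    · simp [← h] at h1
    · exact h
  have hs1 : 0 < Real.sin (ω - α) := by
    by_contra! h
    nlinarith
  have hs2 : Real.sin (ω - β) < 0 := by
    by_contra! h
    nlinarith
  have hαω : α < ω := by
    rcases hω1.eq_or_lt with h | h
    · simp [← h] at hs1
    · exact h
  have hωα : ω - α < π := by
    by_contra! h
    have := Real.sin_nonpos_of_nonpos_of_neg_pi_le (x := ω - α - 2 * π) (by linarith)
      (by linarith)
    rw [Real.sin_sub_two_pi] at this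
    linarith
  have hωβ : ω < β := by
    by_contra! h
    have := Real.sin_nonneg_of_nonneg_of_le_pi (x := ω - β) (by linarith) (by linarith)
    linarith
  exact ⟨r, ω, hr0, hA.trans_lt hαω, hωβ.trans_le hB, hy0, hy1⟩

lemma exists_convex_subsector {A B : ℝ} {x : E2} (hx : x ∈ sector A B) :
    ∃ α β : ℝ, A ≤ α ∧ β ≤ B ∧ β - α ≤ 2 ∧ min (B - A) 1 ≤ β - α ∧
      0 < inner ℝ (rayNormal α) x ∧ inner ℝ (rayNormal β) x < 0 := by
  obtain ⟨r, φ, hr, hA, hB, h0, h1⟩ := hx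
  have hpi := Real.pi_gt_three
  have hα : max A (φ - 1) < φ := by simp [hA]
  have hα' : φ - 1 ≤ max A (φ - 1) := le_max_right _ _
  have hβ : φ < min B (φ + 1) := by simp [hB]
  have hβ' : min B (φ + 1) ≤ φ + 1 := min_le_right _ _
  refine ⟨max A (φ - 1), min B (φ + 1), le_max_left _ _, min_le_left _ _, by linarith, ?_, ?_, ?_⟩
  · rcases max_cases A (φ - 1) with h | h <;> rcases min_cases B (φ + 1) with h' | h' <;>
      rcases min_cases (B - A) 1 with h'' | h'' <;> linarith
  · rw [inner_rayNormal_polar h0 h1]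
    exact mul_pos hr (Real.sin_pos_of_pos_of_lt_pi (by linarith) (by linarith))
  · rw [inner_rayNormal_polar h0 h1]
    exact mul_neg_of_pos_of_neg hr (Real.sin_neg_of_neg_of_neg_pi_lt (by linarith) (by linarith))

lemma isOpen_sector (A B : ℝ) : IsOpen (sector A B) := by
  rw [isOpen_iff_forall_mem_open]
  intro x hx
  have hpi := Real.pi_gt_three
  have hAB : A < B := by
    obtain ⟨r, φ, -, h1, h2, -⟩ := hx
    exact h1.trans h2
  obtain ⟨α, β, hα, hβ, h2, h3, h4, h5⟩ := exists_convex_subsector hx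
  have h6 : 0 < min (B - A) 1 := lt_min (by linarith) one_pos
  refine ⟨{y | 0 < inner ℝ (rayNormal α) y} ∩ {y | inner ℝ (rayNormal β) y < 0}, ?_, ?_, h4, h5⟩
  · rintro y ⟨hy1, hy2⟩
    exact mem_sector_of_inner hα hβ (by linarith) hy1 hy2
  · exact (isOpen_lt continuous_const (by fun_prop)).inter (isOpen_lt (by fun_prop) continuous_const)

/-- Interior corkscrew condition, in the form of an explicit interior ball. -/
lemma exists_ball_subset_sector {A B : ℝ} {x : E2} (hx : x ∈ sector A B) {t : ℝ} (ht : 0 < t) :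
    ∃ z : E2, dist z x = t ∧
      Metric.ball z (t * Real.sin (min (B - A) 1 / 2)) ⊆ sector A B := by
  have hpi := Real.pi_gt_three
  have hAB : A < B := by
    obtain ⟨r, φ, -, h1, h2, -⟩ := hx
    exact h1.trans h2
  obtain ⟨α, β, hα, hβ, h2, h3, h4, h5⟩ := exists_convex_subsector hx
  have h6 : 0 < min (B - A) 1 := lt_min (by linarith) one_pos
  set e : E2 := !₂[Real.cos ((α + β) / 2), Real.sin ((α + β) / 2)] with he
  have he0 : e 0 = 1 * Real.cos ((α + β) / 2) := by simp [he]
  have he1 : e 1 = 1 * Real.sin ((α + β) / 2) := by simp [he]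
  have hnorm : ‖e‖ = 1 := norm_polar zero_le_one he0 he1
  have hsin : Real.sin (min (B - A) 1 / 2) ≤ Real.sin ((β - α) / 2) :=
    Real.sin_le_sin_of_le_of_le_pi_div_two (by linarith) (by linarith) (by linarith)
  have heα : inner ℝ (rayNormal α) e = Real.sin ((β - α) / 2) := by
    rw [inner_rayNormal_polar he0 he1, one_mul]
    congr 1
    ring
  have heβ : inner ℝ (rayNormal β) e = -Real.sin ((β - α) / 2) := by
    rw [inner_rayNormal_polar he0 he1, one_mul, ← Real.sin_neg]
    congr 1
    ring
  have hmul := mul_le_mul_of_nonneg_left hsin ht.le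
  refine ⟨x + t • e, by simp [norm_smul, hnorm, abs_of_pos ht], fun y hy => ?_⟩
  rw [mem_ball_iff_norm] at hy
  have hy' : y = x + t • e + (y - (x + t • e)) := by abel
  have hvα := abs_le.1 (abs_inner_rayNormal_le α (y - (x + t • e)))
  have hvβ := abs_le.1 (abs_inner_rayNormal_le β (y - (x + t • e)))
  refine mem_sector_of_inner hα hβ (by linarith) ?_ ?_
  · rw [hy', inner_add_right, inner_add_right, inner_smul_right, heα]
    linarith
  · rw [hy', inner_add_right, inner_add_right, inner_smul_right, heβ]
    linarith

lemma disjoint_sector {κ : ℝ} : Disjoint (sector 0 κ) (sector κ (2 * π)) := by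
  rw [Set.disjoint_left]
  rintro x ⟨r, φ, hr, hφ, hφ', h0, h1⟩ ⟨s, ψ, hs, hψ, hψ', k0, k1⟩
  have hrs : r = s := (norm_polar hr.le h0 h1).symm.trans (norm_polar hs.le k0 k1)
  subst hrs
  have hc : Real.cos φ = Real.cos ψ := mul_left_cancel₀ hr.ne' (h0.symm.trans k0)
  have hsn : Real.sin φ = Real.sin ψ := mul_left_cancel₀ hr.ne' (h1.symm.trans k1)
  have : Real.cos (φ - ψ) = 1 := by
    rw [Real.cos_sub, hc, hsn]
    linear_combination Real.sin_sq_add_cos_sq ψ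
  rw [Real.cos_eq_one_iff_of_lt_of_lt (by linarith) (by linarith)] at this
  linarith

lemma isOpen_Dset (κ : ℝ) : IsOpen (Dset κ) := isOpen_sector 0 κ

lemma measurableSet_ballD (κ : ℝ) (x : E2) (r : ℝ) : MeasurableSet (ballD κ x r) :=
  ((isOpen_Dset κ).inter Metric.isOpen_ball).measurableSet

lemma norm_pos_of_mem_Dset {κ : ℝ} {x : E2} (hx : x ∈ Dset κ) : 0 < ‖x‖ := by
  obtain ⟨r, φ, hr, -, -, h0, h1⟩ := hx
  rwa [norm_polar hr.le h0 h1]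

lemma frontier_Dset_subset {κ : ℝ} {q : E2} (hq : q ∈ frontier (Dset κ)) :
    inner ℝ (rayNormal 0) q = 0 ∨ inner ℝ (rayNormal κ) q = 0 := by
  rw [(isOpen_Dset κ).frontier_eq] at hq
  obtain ⟨hq1, hq2⟩ := hq
  obtain ⟨r, ω, hr, hω, hω', h0, h1⟩ := exists_polar 0 q
  rw [inner_rayNormal_polar h0 h1, inner_rayNormal_polar h0 h1]
  rcases hr.eq_or_lt with h | hr
  · simp [← h]
  rcases hω.eq_or_lt with h | hω
  · simp [← h]
  rcases lt_trichotomy ω κ with h | h | h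
  · exact absurd ⟨r, ω, hr, hω, h, h0, h1⟩ hq2
  · simp [h]
  · have : q ∈ sector κ (2 * π) := ⟨r, ω, hr, h, by linarith, h0, h1⟩
    exact absurd hq1 (Set.disjoint_right.1
      (disjoint_sector.closure_left (isOpen_sector κ (2 * π))) this)

lemma zero_mem_frontier_Dset {κ : ℝ} (hκ : 0 < κ) : (0 : E2) ∈ frontier (Dset κ) := by
  rw [(isOpen_Dset κ).frontier_eq]
  refine ⟨?_, fun h => by simpa using norm_pos_of_mem_Dset h⟩
  rw [Metric.mem_closure_iff]
  intro ε hε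
  set e : E2 := !₂[ε / 2 * Real.cos (κ / 2), ε / 2 * Real.sin (κ / 2)] with he
  have he0 : e 0 = ε / 2 * Real.cos (κ / 2) := by simp [he]
  have he1 : e 1 = ε / 2 * Real.sin (κ / 2) := by simp [he]
  refine ⟨e, ⟨ε / 2, κ / 2, by linarith, by linarith, by linarith, he0, he1⟩, ?_⟩
  rw [dist_zero_left, norm_polar (by linarith) he0 he1]
  linarith

lemma rhoD_nonneg (κ : ℝ) (x : E2) : 0 ≤ rhoD κ x := Metric.infDist_nonneg

lemma rhoD_le_norm {κ : ℝ} (hκ : 0 < κ) (x : E2) : rhoD κ x ≤ ‖x‖ := by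
  simpa [rhoD] using Metric.infDist_le_dist_of_mem (x := x) (zero_mem_frontier_Dset hκ)

lemma rhoD_le_add (κ : ℝ) (x y : E2) : rhoD κ x ≤ rhoD κ y + dist x y :=
  Metric.infDist_le_infDist_add_dist

lemma continuous_rhoD (κ : ℝ) : Continuous (rhoD κ) := Metric.continuous_infDist_pt _

lemma le_rhoD_of_ball_subset {κ : ℝ} (hκ : 0 < κ) {z : E2} {s : ℝ}
    (h : Metric.ball z s ⊆ Dset κ) : s ≤ rhoD κ z := by
  refine (Metric.le_infDist ⟨0, zero_mem_frontier_Dset hκ⟩).2 fun q hq => ?_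
  by_contra! hlt
  rw [(isOpen_Dset κ).frontier_eq] at hq
  exact hq.2 (h (by rwa [Metric.mem_ball, dist_comm]))

lemma rhoD_pos {κ : ℝ} (hκ : 0 < κ) {x : E2} (hx : x ∈ Dset κ) : 0 < rhoD κ x := by
  obtain ⟨ε, hε, h⟩ := Metric.isOpen_iff.1 (isOpen_Dset κ) x hx
  exact hε.trans_le (le_rhoD_of_ball_subset hκ h)

lemma min_abs_inner_le_rhoD {κ : ℝ} (hκ : 0 < κ) (y : E2) :
    min |inner ℝ (rayNormal 0) y| |inner ℝ (rayNormal κ) y| ≤ rhoD κ y := by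
  refine (Metric.le_infDist ⟨0, zero_mem_frontier_Dset hκ⟩).2 fun q hq => ?_
  have key : ∀ α, inner ℝ (rayNormal α) q = 0 → |inner ℝ (rayNormal α) y| ≤ dist y q := by
    intro α hα
    have := abs_inner_rayNormal_le α (y - q)
    rwa [inner_sub_right, hα, sub_zero, ← dist_eq_norm] at this
  rcases frontier_Dset_subset hq with h | h
  · exact (min_le_left _ _).trans (key 0 h)
  · exact (min_le_right _ _).trans (key κ h)

/-- Interior corkscrew condition for `Dset`, scaled so that the ball stays away from the boundary
at the scale `rhoD κ x + r`. -/
lemma exists_corkscrew {κ : ℝ} (hκ : 0 < κ) :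
    ∃ c : ℝ, 0 < c ∧ c ≤ 1 ∧ ∀ x ∈ Dset κ, ∀ r : ℝ, 0 < r → ∃ z : E2,
      Metric.ball z (c * r) ⊆ ballD κ x r ∧
      ∀ y ∈ Metric.ball z (c * r), c * (rhoD κ x + r) ≤ rhoD κ y := by
  have hpi := Real.pi_gt_three
  set s := Real.sin (min (κ - 0) 1 / 2) with hs
  have hm : 0 < min (κ - 0) 1 := lt_min (by linarith) one_pos
  have hm' : min (κ - 0) 1 ≤ 1 := min_le_right _ _
  have hs0 : 0 < s := Real.sin_pos_of_pos_of_lt_pi (by linarith) (by linarith)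
  have hs1 : s ≤ 1 := Real.sin_le_one _
  refine ⟨s / 16, by linarith, by linarith, fun x hx r hr => ?_⟩
  have hsr : s * r ≤ r := by nlinarith
  have hsr0 : 0 < s * r := mul_pos hs0 hr
  obtain ⟨z, hz, hball⟩ := exists_ball_subset_sector (A := 0) (B := κ) hx (t := r / 2) (by linarith)
  rw [← hs] at hball
  have hz' := le_rhoD_of_ball_subset hκ hball
  refine ⟨z, fun y hy => ⟨hball ?_, ?_⟩, fun y hy => ?_⟩
  · rw [Metric.mem_ball] at hy ⊢
    linarith
  · rw [Metric.mem_ball] at hy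
    have := dist_triangle y z x
    linarith
  · rw [Metric.mem_ball'] at hy
    rcases le_or_gt (2 * r) (rhoD κ x) with h | h
    · have h1 := rhoD_le_add κ x y
      have h2 : s * (rhoD κ x + r) ≤ 1 * (rhoD κ x + r) :=
        mul_le_mul_of_nonneg_right hs1 (by linarith)
      have h3 := dist_triangle x z y
      rw [dist_comm x z] at h3
      linarith
    · have h1 := rhoD_le_add κ z y
      have h2 : s * (rhoD κ x + r) ≤ s * (3 * r) :=
        mul_le_mul_of_nonneg_left (by linarith) hs0.le
      linarith

/-! ### Integrals of powers of the distance to a line -/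

lemma lintegral_Ioo_zero_rpow {a r : ℝ} (ha : -1 < a) (hr : 0 < r) :
    ∫⁻ s in Ioo 0 r, ENNReal.ofReal |s| ^ a = ENNReal.ofReal (r ^ (1 + a) / (1 + a)) := by
  have h1 : ∫⁻ s in Ioo 0 r, ENNReal.ofReal |s| ^ a = ∫⁻ s in Ioo 0 r, ENNReal.ofReal (s ^ a) :=
    setLIntegral_congr_fun measurableSet_Ioo fun s hs => by
      simp only [abs_of_pos hs.1, ENNReal.ofReal_rpow_of_pos hs.1]
  have hint : IntegrableOn (fun s : ℝ => s ^ a) (Ioo 0 r) :=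
    (intervalIntegral.integrableOn_Ioo_rpow_iff hr).2 ha
  rw [h1, ← ofReal_integral_eq_lintegral_ofReal hint
    ((ae_restrict_mem measurableSet_Ioo).mono fun s hs => Real.rpow_nonneg hs.1.le _),
    ← integral_Ioc_eq_integral_Ioo, ← intervalIntegral.integral_of_le hr.le,
    integral_rpow (Or.inl ha), Real.zero_rpow (by linarith), sub_zero, add_comm]

lemma lintegral_Ioo_symm_rpow_le {a r : ℝ} (ha : -1 < a) (hr : 0 < r) :
    ∫⁻ s in Ioo (-r) r, ENNReal.ofReal |s| ^ a ≤ ENNReal.ofReal (2 * (r ^ (1 + a) / (1 + a))) := by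
  have ha1 : 0 < 1 + a := by linarith
  have hneg : ∫⁻ s in Ioo (-r) 0, ENNReal.ofReal |s| ^ a =
      ∫⁻ s in Ioo 0 r, ENNReal.ofReal |s| ^ a := by
    rw [← (Measure.measurePreserving_neg (volume : Measure ℝ)).setLIntegral_comp_preimage_emb
      (MeasurableEquiv.neg ℝ).measurableEmbedding _ (Ioo 0 r)]
    simp
  have hsub : Ioo (-r) r ⊆ Ioo (-r) 0 ∪ ({0} ∪ Ioo 0 r) := by
    intro s hs
    rcases lt_trichotomy s 0 with h | h | h
    · exact Or.inl ⟨hs.1, h⟩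
    · exact Or.inr (Or.inl h)
    · exact Or.inr (Or.inr ⟨h, hs.2⟩)
  refine (lintegral_mono_set hsub).trans <| (lintegral_union_le _ _ _).trans <|
    (add_le_add le_rfl (lintegral_union_le _ _ _)).trans ?_
  rw [hneg, lintegral_Ioo_zero_rpow ha hr, setLIntegral_measure_zero _ _ (by simp), zero_add,
    ← ENNReal.ofReal_add (by positivity) (by positivity), two_mul]

lemma ennreal_rpow_le_rpow_of_nonpos {a : ℝ} (ha : a ≤ 0) {s t : ℝ≥0∞} (h : s ≤ t) :
    t ^ a ≤ s ^ a := by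
  rw [← neg_neg a, ENNReal.rpow_neg t (-a), ENNReal.rpow_neg s (-a)]
  exact ENNReal.inv_le_inv.2 (ENNReal.rpow_le_rpow h (neg_nonneg.2 ha))

lemma measurable_ofReal_abs_rpow (a : ℝ) : Measurable fun s : ℝ => ENNReal.ofReal |s| ^ a := by
  fun_prop

lemma exists_lintegral_Ioo_rpow_le {a : ℝ} (ha : -1 < a) (ha0 : a ≤ 0) :
    ∃ C : ℝ, 0 < C ∧ ∀ s₀ r : ℝ, 0 < r →
      ∫⁻ s in Ioo (s₀ - r) (s₀ + r), ENNReal.ofReal |s| ^ a ≤ ENNReal.ofReal (C * r ^ (1 + a)) := by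
  have ha1 : 0 < 1 + a := by linarith
  refine ⟨2 / (1 + a) + 2, by positivity, fun s₀ r hr => ?_⟩
  have hpt : ∀ s : ℝ, ENNReal.ofReal |s| ^ a ≤
      (Ioo (-r) r).indicator (fun s => ENNReal.ofReal |s| ^ a) s + ENNReal.ofReal (r ^ a) := by
    intro s
    by_cases hs : s ∈ Ioo (-r) r
    · rw [indicator_of_mem hs]
      exact le_self_add
    · rw [indicator_of_notMem hs, zero_add, ← ENNReal.ofReal_rpow_of_pos hr]
      refine ennreal_rpow_le_rpow_of_nonpos ha0 (ENNReal.ofReal_le_ofReal ?_)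
      by_contra! h
      exact hs (abs_lt.1 h)
  calc ∫⁻ s in Ioo (s₀ - r) (s₀ + r), ENNReal.ofReal |s| ^ a
      ≤ ∫⁻ s in Ioo (s₀ - r) (s₀ + r),
          ((Ioo (-r) r).indicator (fun s => ENNReal.ofReal |s| ^ a) s + ENNReal.ofReal (r ^ a)) :=
        lintegral_mono hpt
    _ ≤ ENNReal.ofReal (2 * (r ^ (1 + a) / (1 + a))) +
          ENNReal.ofReal (r ^ a) * ENNReal.ofReal (2 * r) := by
        rw [lintegral_add_right _ measurable_const, setLIntegral_const, Real.volume_Ioo,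
          show s₀ + r - (s₀ - r) = 2 * r by ring]
        refine add_le_add (le_trans ?_ (lintegral_Ioo_symm_rpow_le ha hr)) le_rfl
        refine (setLIntegral_le_lintegral _ _).trans ?_
        rw [lintegral_indicator measurableSet_Ioo]
    _ = ENNReal.ofReal ((2 / (1 + a) + 2) * r ^ (1 + a)) := by
        rw [← ENNReal.ofReal_mul (by positivity), ← ENNReal.ofReal_add (by positivity) (by positivity)]
        congr 1
        rw [Real.rpow_add hr, Real.rpow_one]
        ring

lemma exists_orthonormalBasis_one_eq {n : E2} (hn : ‖n‖ = 1) :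
    ∃ b : OrthonormalBasis (Fin 2) ℝ E2, b 1 = n := by
  have h : Orthonormal ℝ (({1} : Set (Fin 2)).domRestrict fun _ => n) :=
    ⟨fun _ => hn, fun i j hij => absurd (Subsingleton.elim i j) hij⟩
  obtain ⟨b, hb⟩ := h.exists_orthonormalBasis_extension_of_card_eq (by simp)
  exact ⟨b, hb 1 rfl⟩

lemma exists_lintegral_ball_inner_rpow_le {a : ℝ} (ha : -1 < a) (ha0 : a ≤ 0) :
    ∃ C : ℝ, 0 < C ∧ ∀ n : E2, ‖n‖ = 1 → ∀ (x : E2) (r : ℝ), 0 < r →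
      ∫⁻ y in Metric.ball x r, ENNReal.ofReal |inner ℝ n y| ^ a ≤
        ENNReal.ofReal (C * r ^ (2 + a)) := by
  obtain ⟨C, hC, hbound⟩ := exists_lintegral_Ioo_rpow_le ha ha0
  refine ⟨2 * C, by positivity, fun n hn x r hr => ?_⟩
  obtain ⟨b, rfl⟩ := exists_orthonormalBasis_one_eq hn
  set T : E2 → ℝ × ℝ := fun y => MeasurableEquiv.finTwoArrow (WithLp.ofLp (b.repr y)) with hT
  have hTmp : MeasurePreserving T volume volume :=
    (volume_preserving_finTwoArrow ℝ).comp
      ((PiLp.volume_preserving_ofLp (Fin 2)).comp b.measurePreserving_repr)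
  have hT1 : ∀ y, (T y).1 = b.repr y 0 := fun y => rfl
  have hT2 : ∀ y, (T y).2 = b.repr y 1 := fun y => rfl
  have hcoord : ∀ (y : E2) (i : Fin 2), y ∈ Metric.ball x r →
      b.repr y i ∈ Ioo (b.repr x i - r) (b.repr x i + r) := by
    intro y i hy
    have h1 : |b.repr y i - b.repr x i| ≤ dist y x := by
      rw [← b.repr.dist_map, dist_eq_norm]
      exact PiLp.norm_apply_le (b.repr y - b.repr x) i
    have h2 := abs_lt.1 (h1.trans_lt (Metric.mem_ball.1 hy))
    exact ⟨by linarith, by linarith⟩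
  set I := Ioo (b.repr x 0 - r) (b.repr x 0 + r)
  set J := Ioo (b.repr x 1 - r) (b.repr x 1 + r)
  have hsub : Metric.ball x r ⊆ T ⁻¹' (I ×ˢ J) := fun y hy => ⟨hcoord y 0 hy, hcoord y 1 hy⟩
  calc ∫⁻ y in Metric.ball x r, ENNReal.ofReal |inner ℝ (b 1) y| ^ a
      ≤ ∫⁻ y in T ⁻¹' (I ×ˢ J), ENNReal.ofReal |(T y).2| ^ a := by
        simp only [hT2, b.repr_apply_apply]
        exact lintegral_mono_set hsub
    _ = ∫⁻ z in I ×ˢ J, ENNReal.ofReal |z.2| ^ a :=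
        hTmp.setLIntegral_comp_preimage (f := fun z : ℝ × ℝ => ENNReal.ofReal |z.2| ^ a)
          (measurableSet_Ioo.prod measurableSet_Ioo) (by fun_prop)
    _ = ENNReal.ofReal (2 * r) * ∫⁻ s in J, ENNReal.ofReal |s| ^ a := by
        rw [Measure.volume_eq_prod, ← Measure.prod_restrict]
        have := lintegral_prod_mul (μ := (volume : Measure ℝ).restrict I)
          (ν := (volume : Measure ℝ).restrict J) (f := fun _ => 1)
          (g := fun s => ENNReal.ofReal |s| ^ a) aemeasurable_const
          (measurable_ofReal_abs_rpow a).aemeasurable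
        simp only [one_mul] at this
        rw [this, setLIntegral_one, Real.volume_Ioo]
        congr 2
        ring
    _ ≤ ENNReal.ofReal (2 * r) * ENNReal.ofReal (C * r ^ (1 + a)) := by
        gcongr
        exact hbound _ _ hr
    _ = ENNReal.ofReal (2 * C * r ^ (2 + a)) := by
        rw [← ENNReal.ofReal_mul (by positivity)]
        congr 1
        rw [show 2 + a = 1 + (1 + a) by ring, Real.rpow_add hr 1 (1 + a), Real.rpow_one]
        ring

/-! ### Two-sided bounds for the weighted measure of balls -/

lemma rpow_le_mul_rpow {k s S : ℝ} (hk : 1 ≤ k) (hs : 0 < s) (hS : 0 < S) (h1 : S ≤ k * s)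
    (h2 : s ≤ k * S) (e : ℝ) : s ^ e ≤ k ^ |e| * S ^ e := by
  have hk0 : 0 < k := by linarith
  rcases le_total 0 e with he | he
  · rw [abs_of_nonneg he, ← Real.mul_rpow hk0.le hS.le]
    exact Real.rpow_le_rpow hs.le h2 he
  · have h3 : (k * s) ^ e ≤ S ^ e := Real.rpow_le_rpow_of_nonpos hS h1 he
    rw [Real.mul_rpow hk0.le hs.le] at h3
    rw [abs_of_nonpos he, Real.rpow_neg hk0.le, ← div_eq_inv_mul, le_div_iff₀ (by positivity)]
    linarith

lemma volume_ball_eq (x : E2) {r : ℝ} (hr : 0 < r) :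
    volume (Metric.ball x r) = ENNReal.ofReal (π * r ^ 2) := by
  rw [EuclideanSpace.volume_ball_fin_two, ENNReal.ofReal_mul Real.pi_pos.le,
    ENNReal.ofReal_pow hr.le, mul_comm]

lemma volume_ballD_le (κ : ℝ) (x : E2) {r : ℝ} (hr : 0 < r) :
    volume (ballD κ x r) ≤ ENNReal.ofReal (π * r ^ 2) :=
  (measure_mono fun _ hy => hy.2).trans (volume_ball_eq x hr).le

lemma lintegral_ballD_le_of_le {κ : ℝ} {x : E2} {r K : ℝ} (hr : 0 < r) (hK : 0 ≤ K) {f : E2 → ℝ}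
    (hf : ∀ y ∈ ballD κ x r, f y ≤ K) :
    ∫⁻ y in ballD κ x r, ENNReal.ofReal (f y) ≤ ENNReal.ofReal (K * (π * r ^ 2)) := by
  calc ∫⁻ y in ballD κ x r, ENNReal.ofReal (f y)
      ≤ ∫⁻ _ in ballD κ x r, ENNReal.ofReal K :=
        setLIntegral_mono measurable_const fun y hy => ENNReal.ofReal_le_ofReal (hf y hy)
    _ ≤ ENNReal.ofReal K * ENNReal.ofReal (π * r ^ 2) := by
        rw [setLIntegral_const]
        gcongr
        exact volume_ballD_le κ x hr
    _ = _ := (ENNReal.ofReal_mul hK).symm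

lemma exists_lintegral_rhoD_rpow_le {κ : ℝ} (hκ : 0 < κ) {a : ℝ} (ha : -1 < a) :
    ∃ C : ℝ, 0 < C ∧ ∀ (z : E2) (R : ℝ), 0 < R → rhoD κ z ≤ 2 * R →
      ∫⁻ y in ballD κ z R, ENNReal.ofReal (rhoD κ y ^ a) ≤ ENNReal.ofReal (C * R ^ (2 + a)) := by
  rcases le_total 0 a with ha0 | ha0
  · refine ⟨3 ^ a * π, by positivity, fun z R hR hz => ?_⟩
    refine (lintegral_ballD_le_of_le (K := (3 * R) ^ a) hR (by positivity) fun y hy => ?_).trans_eq ?_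
    · have h1 := rhoD_le_add κ y z
      have h2 := hy.2
      exact Real.rpow_le_rpow (rhoD_nonneg κ y) (by linarith) ha0
    · congr 1
      rw [Real.mul_rpow (by norm_num) hR.le, Real.rpow_add hR, Real.rpow_two]
      ring
  · obtain ⟨C, hC, hbound⟩ := exists_lintegral_ball_inner_rpow_le ha ha0
    refine ⟨2 * C, by positivity, fun z R hR _ => ?_⟩
    set f : ℝ → E2 → ℝ≥0∞ := fun α y => ENNReal.ofReal |inner ℝ (rayNormal α) y| ^ a with hf
    have hfm : ∀ α, Measurable (f α) := fun α => by
      have : Measurable fun y : E2 => (inner ℝ (rayNormal α) y : ℝ) :=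
        (by fun_prop : Continuous fun y : E2 => (inner ℝ (rayNormal α) y : ℝ)).measurable
      exact (measurable_ofReal_abs_rpow a).comp this
    calc ∫⁻ y in ballD κ z R, ENNReal.ofReal (rhoD κ y ^ a)
        ≤ ∫⁻ y in ballD κ z R, (f 0 y + f κ y) := by
          refine setLIntegral_mono ((hfm 0).add (hfm κ)) fun y hy => ?_
          rw [← ENNReal.ofReal_rpow_of_pos (rhoD_pos hκ hy.1)]
          rcases min_le_iff.1 (min_abs_inner_le_rhoD hκ y) with h | h
          · exact (ennreal_rpow_le_rpow_of_nonpos ha0 (ENNReal.ofReal_le_ofReal h)).trans le_self_add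
          · exact (ennreal_rpow_le_rpow_of_nonpos ha0 (ENNReal.ofReal_le_ofReal h)).trans le_add_self
      _ ≤ ∫⁻ y in Metric.ball z R, (f 0 y + f κ y) := lintegral_mono_set fun _ hy => hy.2
      _ = (∫⁻ y in Metric.ball z R, f 0 y) + ∫⁻ y in Metric.ball z R, f κ y :=
          lintegral_add_left (hfm 0) _
      _ ≤ ENNReal.ofReal (C * R ^ (2 + a)) + ENNReal.ofReal (C * R ^ (2 + a)) :=
          add_le_add (hbound _ (norm_rayNormal 0) z R hR) (hbound _ (norm_rayNormal κ) z R hR)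
      _ = ENNReal.ofReal (2 * C * R ^ (2 + a)) := by
          rw [← ENNReal.ofReal_add (by positivity) (by positivity)]
          congr 1
          ring

lemma lintegral_wgt_le_of_norm {κ a b K M : ℝ} (hK : 0 ≤ K) {S T : Set E2} (hST : S ⊆ T)
    (hS : ∀ y ∈ S, ‖y‖ ^ (b - a) ≤ K)
    (hT : ∫⁻ y in T, ENNReal.ofReal (rhoD κ y ^ a) ≤ ENNReal.ofReal M) :
    wMeas κ a b S ≤ ENNReal.ofReal (K * M) := by
  have hm : Measurable fun y => ENNReal.ofReal (rhoD κ y ^ a) :=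
    ((continuous_rhoD κ).measurable.pow_const a).ennreal_ofReal
  calc wMeas κ a b S
      ≤ ∫⁻ y in S, ENNReal.ofReal K * ENNReal.ofReal (rhoD κ y ^ a) := by
        refine setLIntegral_mono (hm.const_mul _) fun y hy => ?_
        rw [← ENNReal.ofReal_mul hK]
        exact ENNReal.ofReal_le_ofReal (mul_le_mul_of_nonneg_right (hS y hy)
          (Real.rpow_nonneg (rhoD_nonneg κ y) a))
    _ = ENNReal.ofReal K * ∫⁻ y in S, ENNReal.ofReal (rhoD κ y ^ a) := lintegral_const_mul _ hm
    _ ≤ ENNReal.ofReal K * ENNReal.ofReal M := by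
        gcongr
        exact (lintegral_mono_set hST).trans hT
    _ = ENNReal.ofReal (K * M) := (ENNReal.ofReal_mul hK).symm

lemma exists_wMeas_ballD_zero_le {κ : ℝ} (hκ : 0 < κ) {a b : ℝ} (ha : -1 < a) (hb : -2 < b) :
    ∃ C : ℝ, 0 < C ∧ ∀ R : ℝ, 0 < R →
      wMeas κ a b (ballD κ 0 R) ≤ ENNReal.ofReal (C * R ^ (2 + b)) := by
  obtain ⟨C, hC, hbound⟩ := exists_lintegral_rhoD_rpow_le hκ ha
  set q : ℝ := (1 / 2) ^ (2 + b) with hq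
  have hq0 : 0 < q := by positivity
  have hq1 : q < 1 := Real.rpow_lt_one (by norm_num) (by norm_num) (by linarith)
  have hq1' : 0 < 1 - q := by linarith
  refine ⟨2 ^ |b - a| * C * 2 ^ (2 + a) * (1 - q)⁻¹, by positivity, fun R hR => ?_⟩
  set ρ : ℕ → ℝ := fun k => R * (1 / 2) ^ k with hρ
  have hρ0 : ∀ k, 0 < ρ k := fun k => by positivity
  set S : ℕ → Set E2 := fun k => {y | y ∈ Dset κ ∧ ρ k ≤ 2 * ‖y‖ ∧ ‖y‖ ≤ ρ k}
  have hcover : ballD κ 0 R ⊆ ⋃ k, S k := by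
    rintro y ⟨hyD, hy⟩
    rw [dist_zero_right] at hy
    have hy0 := norm_pos_of_mem_Dset hyD
    obtain ⟨k, hk1, hk2⟩ := exists_nat_pow_near_of_lt_one (x := ‖y‖ / R) (y := 1 / 2)
      (by positivity) ((div_le_one hR).2 hy.le) (by norm_num) (by norm_num)
    rw [lt_div_iff₀ hR] at hk1
    rw [div_le_iff₀ hR] at hk2
    rw [pow_succ] at hk1
    refine mem_iUnion.2 ⟨k, hyD, ?_, ?_⟩ <;> simp only [hρ] <;> linarith
  have hshell : ∀ k, wMeas κ a b (S k) ≤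
      ENNReal.ofReal (2 ^ |b - a| * C * 2 ^ (2 + a) * R ^ (2 + b) * q ^ k) := by
    intro k
    have hsub : S k ⊆ ballD κ 0 (2 * ρ k) := fun y hy => ⟨hy.1, by
      rw [dist_zero_right]
      linarith [hy.2.2, hρ0 k]⟩
    refine (lintegral_wgt_le_of_norm (K := 2 ^ |b - a| * ρ k ^ (b - a)) (by positivity) hsub
      (fun y hy => ?_) (hbound 0 (2 * ρ k) (by linarith [hρ0 k]) ?_)).trans_eq ?_
    · have := hy.2.2
      exact rpow_le_mul_rpow one_le_two (norm_pos_of_mem_Dset hy.1) (hρ0 k) hy.2.1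
        (by linarith [hρ0 k]) _
    · exact (rhoD_le_norm hκ 0).trans (by simpa using (hρ0 k).le)
    · congr 1
      have h1 : ρ k ^ (b - a) * ρ k ^ (2 + a) = R ^ (2 + b) * q ^ k := by
        rw [← Real.rpow_add (hρ0 k), show b - a + (2 + a) = 2 + b by ring, hρ,
          Real.mul_rpow hR.le (by positivity), hq, ← Real.rpow_natCast, ← Real.rpow_natCast,
          ← Real.rpow_mul (by norm_num), ← Real.rpow_mul (by norm_num), mul_comm (k : ℝ)]
      rw [Real.mul_rpow zero_le_two (hρ0 k).le]
      linear_combination (2 ^ |b - a| * C * 2 ^ (2 + a)) * h1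
  calc wMeas κ a b (ballD κ 0 R) ≤ ∑' k, wMeas κ a b (S k) :=
        (lintegral_mono_set hcover).trans (lintegral_iUnion_le _ _)
    _ ≤ ∑' k, ENNReal.ofReal (2 ^ |b - a| * C * 2 ^ (2 + a) * R ^ (2 + b) * q ^ k) := ENNReal.tsum_le_tsum hshell
    _ = ENNReal.ofReal (2 ^ |b - a| * C * 2 ^ (2 + a) * (1 - q)⁻¹ * R ^ (2 + b)) := by
        rw [← ENNReal.ofReal_tsum_of_nonneg (fun k => by positivity)
          ((summable_geometric_of_lt_one hq0.le hq1).mul_left _), tsum_mul_left,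
          tsum_geometric_of_lt_one hq0.le hq1]
        congr 1
        ring

/-- The comparison quantity for the `w_{a,b}`-measure of `B(x, r)`. -/
def ballSize (κ a b : ℝ) (x : E2) (r : ℝ) : ℝ :=
  r ^ 2 * ((‖x‖ + r) ^ (b - a) * (rhoD κ x + r) ^ a)

lemma exists_wMeas_le {κ : ℝ} (hκ : 0 < κ) {a b : ℝ} (ha : -1 < a) (hb : -2 < b) :
    ∃ C : ℝ, 0 < C ∧ ∀ x ∈ Dset κ, ∀ r : ℝ, 0 < r →
      wMeas κ a b (ballD κ x r) ≤ ENNReal.ofReal (C * ballSize κ a b x r) := by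
  obtain ⟨C₀, hC₀, hzero⟩ := exists_wMeas_ballD_zero_le hκ ha hb
  obtain ⟨C₁, hC₁, hrho⟩ := exists_lintegral_rhoD_rpow_le hκ ha
  set N : ℝ := 3 ^ |b - a| with hN
  set P : ℝ := 3 ^ |a| with hP
  have hN0 : 0 < N := by positivity
  have hP0 : 0 < P := by positivity
  refine ⟨N * P * π + N * C₁ * P + C₀ * 3 ^ (2 + b) * N * P, by positivity, fun x hx r hr => ?_⟩
  have hx0 := norm_pos_of_mem_Dset hx
  have hρ0 := rhoD_pos hκ hx
  have hρx := rhoD_le_norm hκ x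
  set X := ‖x‖ + r with hX
  set Y := rhoD κ x + r with hY
  have hX0 : 0 < X := by positivity
  have hY0 : 0 < Y := by positivity
  have hsize : 0 < ballSize κ a b x r := by
    unfold ballSize
    positivity
  have hmono : ∀ c : ℝ, c ≤ N * P * π + N * C₁ * P + C₀ * 3 ^ (2 + b) * N * P →
      ENNReal.ofReal (c * ballSize κ a b x r) ≤ ENNReal.ofReal
        ((N * P * π + N * C₁ * P + C₀ * 3 ^ (2 + b) * N * P) * ballSize κ a b x r) :=
    fun c hc => ENNReal.ofReal_le_ofReal (mul_le_mul_of_nonneg_right hc hsize.le)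
  have hp1 : 0 < N * P * π := by positivity
  have hp2 : 0 < N * C₁ * P := by positivity
  have hp3 : 0 < C₀ * 3 ^ (2 + b) * N * P := by positivity
  rcases le_or_gt (2 * r) ‖x‖ with hxr | hxr
  · have hnorm : ∀ y ∈ ballD κ x r, ‖y‖ ^ (b - a) ≤ N * X ^ (b - a) := by
      intro y hy
      have h1 : dist y x < r := hy.2
      have h2 := norm_sub_norm_le y x
      have h3 := norm_sub_norm_le x y
      rw [← dist_eq_norm] at h2 h3
      rw [dist_comm] at h3
      exact rpow_le_mul_rpow (by norm_num) (norm_pos_of_mem_Dset hy.1) hX0 (by linarith)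
        (by linarith) _
    rcases le_or_gt (2 * r) (rhoD κ x) with hρr | hρr
    · refine le_trans ?_ (hmono (N * P * π) (by linarith))
      refine (lintegral_ballD_le_of_le (K := N * X ^ (b - a) * (P * Y ^ a)) hr (by positivity)
        fun y hy => ?_).trans_eq ?_
      · have h1 : dist y x < r := hy.2
        have h2 := rhoD_le_add κ y x
        have h3 := rhoD_le_add κ x y
        rw [dist_comm] at h3
        exact mul_le_mul (hnorm y hy) (rpow_le_mul_rpow (by norm_num) (rhoD_pos hκ hy.1) hY0
          (by linarith) (by linarith) _) (Real.rpow_nonneg (rhoD_nonneg κ y) a) (by positivity)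
      · congr 1
        unfold ballSize
        ring
    · refine le_trans ?_ (hmono (N * C₁ * P) (by linarith))
      refine (lintegral_wgt_le_of_norm (by positivity) subset_rfl hnorm
        (hrho x r hr hρr.le)).trans (ENNReal.ofReal_le_ofReal ?_)
      have h1 : r ^ a ≤ P * Y ^ a :=
        rpow_le_mul_rpow (by norm_num) hr hY0 (by linarith) (by linarith) _
      rw [Real.rpow_add hr, Real.rpow_two]
      calc N * X ^ (b - a) * (C₁ * (r ^ 2 * r ^ a))
          ≤ N * X ^ (b - a) * (C₁ * (r ^ 2 * (P * Y ^ a))) := by gcongr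
        _ = N * C₁ * P * ballSize κ a b x r := by
            unfold ballSize
            ring
  · refine le_trans ?_ (hmono (C₀ * 3 ^ (2 + b) * N * P) (by linarith))
    have hsub : ballD κ x r ⊆ ballD κ 0 (3 * r) := by
      rintro y ⟨hyD, hy⟩
      refine ⟨hyD, ?_⟩
      have h2 := norm_sub_norm_le y x
      rw [← dist_eq_norm] at h2
      rw [dist_zero_right]
      linarith
    refine (lintegral_mono_set hsub).trans <| (hzero (3 * r) (by positivity)).trans
      (ENNReal.ofReal_le_ofReal ?_)
    have h1 : r ^ a ≤ P * Y ^ a :=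
      rpow_le_mul_rpow (by norm_num) hr hY0 (by linarith) (by linarith) _
    have h2 : r ^ (b - a) ≤ N * X ^ (b - a) :=
      rpow_le_mul_rpow (by norm_num) hr hX0 (by linarith) (by linarith) _
    have h3 : r ^ (2 + b) = r ^ 2 * (r ^ (b - a) * r ^ a) := by
      rw [← Real.rpow_add hr, ← Real.rpow_two, ← Real.rpow_add hr]
      congr 1
      ring
    rw [Real.mul_rpow (by norm_num) hr.le, h3]
    calc C₀ * (3 ^ (2 + b) * (r ^ 2 * (r ^ (b - a) * r ^ a)))
        ≤ C₀ * (3 ^ (2 + b) * (r ^ 2 * ((N * X ^ (b - a)) * (P * Y ^ a)))) := by gcongr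
      _ = C₀ * 3 ^ (2 + b) * N * P * ballSize κ a b x r := by
          unfold ballSize
          ring

lemma exists_le_wMeas {κ : ℝ} (hκ : 0 < κ) (a b : ℝ) :
    ∃ c : ℝ, 0 < c ∧ ∀ x ∈ Dset κ, ∀ r : ℝ, 0 < r →
      ENNReal.ofReal (c * ballSize κ a b x r) ≤ wMeas κ a b (ballD κ x r) := by
  obtain ⟨c, hc, hc1, hcork⟩ := exists_corkscrew hκ
  set k : ℝ := 3 / c with hk
  have hk0 : 0 < k := by positivity
  have hck : c * k = 3 := by
    rw [hk]
    field_simp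
  have hk1 : 3 ≤ k := by nlinarith
  set N : ℝ := k ^ |b - a| with hN
  set P : ℝ := k ^ |a| with hP
  have hN0 : 0 < N := by positivity
  have hP0 : 0 < P := by positivity
  refine ⟨N⁻¹ * P⁻¹ * π * c ^ 2, by positivity, fun x hx r hr => ?_⟩
  obtain ⟨z, hball, hlow⟩ := hcork x hx r hr
  have hx0 := norm_pos_of_mem_Dset hx
  have hρ0 := rhoD_pos hκ hx
  set X := ‖x‖ + r with hX
  set Y := rhoD κ x + r with hY
  have hX0 : 0 < X := by positivity
  have hY0 : 0 < Y := by positivity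
  have hpt : ∀ y ∈ Metric.ball z (c * r),
      N⁻¹ * X ^ (b - a) * (P⁻¹ * Y ^ a) ≤ wgt κ a b y := by
    intro y hy
    obtain ⟨hyD, hyx⟩ := hball hy
    have hy0 := norm_pos_of_mem_Dset hyD
    have hρy := rhoD_pos hκ hyD
    have hρy' := rhoD_le_norm hκ y
    have hl := hlow y hy
    have h2 := norm_sub_norm_le y x
    have h3 := norm_sub_norm_le x y
    have h4 := rhoD_le_add κ y x
    rw [← dist_eq_norm] at h2 h3
    rw [dist_comm] at h3
    have hYk : Y ≤ k * rhoD κ y := by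
      have := mul_le_mul_of_nonneg_left hl hk0.le
      nlinarith
    have hXk : X ≤ k * ‖y‖ := by
      rcases le_or_gt (2 * r) ‖x‖ with h | h
      · nlinarith
      · have h5 : c * r ≤ ‖y‖ := by nlinarith
        have := mul_le_mul_of_nonneg_left h5 hk0.le
        nlinarith
    have e1 := rpow_le_mul_rpow (k := k) (by linarith) hX0 hy0 (by nlinarith) hXk (b - a)
    have e2 := rpow_le_mul_rpow (k := k) (by linarith) hY0 hρy (by nlinarith) hYk a
    refine mul_le_mul ?_ ?_ (by positivity) (by positivity)
    · rwa [inv_mul_le_iff₀ hN0]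
    · rwa [inv_mul_le_iff₀ hP0]
  calc ENNReal.ofReal (N⁻¹ * P⁻¹ * π * c ^ 2 * ballSize κ a b x r)
      = ENNReal.ofReal (N⁻¹ * X ^ (b - a) * (P⁻¹ * Y ^ a)) * volume (Metric.ball z (c * r)) := by
        rw [volume_ball_eq z (by positivity), ← ENNReal.ofReal_mul (by positivity)]
        congr 1
        unfold ballSize
        ring
    _ = ∫⁻ _ in Metric.ball z (c * r), ENNReal.ofReal (N⁻¹ * X ^ (b - a) * (P⁻¹ * Y ^ a)) :=
        (setLIntegral_const _ _).symm
    _ ≤ ∫⁻ y in Metric.ball z (c * r), ENNReal.ofReal (wgt κ a b y) :=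
        setLIntegral_mono' Metric.isOpen_ball.measurableSet
          fun y hy => ENNReal.ofReal_le_ofReal (hpt y hy)
    _ ≤ wMeas κ a b (ballD κ x r) := lintegral_mono_set hball

lemma wgt_rpow_mul_wgt {κ : ℝ} (hκ : 0 < κ) {y : E2} (hy : y ∈ Dset κ) (γ ν Θ θ e : ℝ) :
    wgt κ γ ν y ^ e * wgt κ Θ θ y = wgt κ (γ * e + Θ) (ν * e + θ) y := by
  have h1 := norm_pos_of_mem_Dset hy
  have h2 := rhoD_pos hκ hy
  unfold wgt
  rw [Real.mul_rpow (by positivity) (by positivity), ← Real.rpow_mul h1.le, ← Real.rpow_mul h2.le,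
    Real.rpow_add h2, show ν * e + θ - (γ * e + Θ) = (ν - γ) * e + (θ - Θ) by ring,
    Real.rpow_add h1]
  ring

lemma exists_average_le {κ : ℝ} (hκ : 0 < κ) {γ ν Θ θ e : ℝ} (hγ : -1 < γ * e + Θ)
    (hν : -2 < ν * e + θ) :
    ∃ C : ℝ, 0 < C ∧ ∀ x ∈ Dset κ, ∀ r : ℝ, 0 < r →
      (wMeas κ Θ θ (ballD κ x r))⁻¹ *
          ∫⁻ y in ballD κ x r, ENNReal.ofReal (wgt κ γ ν y ^ e * wgt κ Θ θ y) ≤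
        ENNReal.ofReal (C * ((‖x‖ + r) ^ (ν - γ) * (rhoD κ x + r) ^ γ) ^ e) := by
  obtain ⟨c, hc, hlow⟩ := exists_le_wMeas hκ Θ θ
  obtain ⟨C, hC, hup⟩ := exists_wMeas_le hκ hγ hν
  refine ⟨C / c, by positivity, fun x hx r hr => ?_⟩
  have hX0 : 0 < ‖x‖ + r := by positivity
  have hY0 : 0 < rhoD κ x + r := add_pos_of_nonneg_of_pos (rhoD_nonneg κ x) hr
  have hs : 0 < ballSize κ Θ θ x r := by
    unfold ballSize
    positivity
  have hint : ∫⁻ y in ballD κ x r, ENNReal.ofReal (wgt κ γ ν y ^ e * wgt κ Θ θ y) =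
      wMeas κ (γ * e + Θ) (ν * e + θ) (ballD κ x r) :=
    setLIntegral_congr_fun (measurableSet_ballD κ x r) fun y hy => by
      simp only [wgt_rpow_mul_wgt hκ hy.1]
  calc _ ≤ (ENNReal.ofReal (c * ballSize κ Θ θ x r))⁻¹ *
        ENNReal.ofReal (C * ballSize κ (γ * e + Θ) (ν * e + θ) x r) := by
        rw [hint]
        exact mul_le_mul' (ENNReal.inv_le_inv.2 (hlow x hx r hr)) (hup x hx r hr)
    _ = _ := by
        rw [← ENNReal.ofReal_inv_of_pos (by positivity), ← ENNReal.ofReal_mul (by positivity)]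
        congr 1
        have : ballSize κ (γ * e + Θ) (ν * e + θ) x r =
            ((‖x‖ + r) ^ (ν - γ) * (rhoD κ x + r) ^ γ) ^ e * ballSize κ Θ θ x r := by
          unfold ballSize
          rw [Real.mul_rpow (by positivity) (by positivity), ← Real.rpow_mul hX0.le,
            ← Real.rpow_mul hY0.le, Real.rpow_add hY0,
            show ν * e + θ - (γ * e + Θ) = (ν - γ) * e + (θ - Θ) by ring, Real.rpow_add hX0]
          ring
        rw [this]
        field_simp

theorem stmt4 (κ : ℝ) (hκ : 0 < κ) (hκ' : κ < 2 * π)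
    (p Θ θ γ ν : ℝ) (hp : 1 < p) (hΘ : -1 < Θ) (hθ : -2 < θ)
    (hγ1 : -(1 + Θ) < γ) (hγ2 : γ < (1 + Θ) * (p - 1))
    (hν1 : -(2 + θ) < ν) (hν2 : ν < (2 + θ) * (p - 1)) :
    ∃ C : ℝ, 0 < C ∧ ∀ x ∈ Dset κ, ∀ r : ℝ, 0 < r →
      ((wMeas κ Θ θ (ballD κ x r))⁻¹ *
          ∫⁻ y in ballD κ x r, ENNReal.ofReal (wgt κ γ ν y * wgt κ Θ θ y)) *
        ((wMeas κ Θ θ (ballD κ x r))⁻¹ *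
          ∫⁻ y in ballD κ x r,
            ENNReal.ofReal (wgt κ γ ν y ^ (-(1 / (p - 1))) * wgt κ Θ θ y)) ^ (p - 1)
      ≤ ENNReal.ofReal C := by
  have hp1 : 0 < p - 1 := by linarith
  obtain ⟨C₁, hC₁, h₁⟩ := exists_average_le hκ (γ := γ) (ν := ν) (Θ := Θ) (θ := θ) (e := 1)
    (by linarith) (by linarith)
  obtain ⟨C₂, hC₂, h₂⟩ := exists_average_le hκ (γ := γ) (ν := ν) (Θ := Θ) (θ := θ)
    (e := -(1 / (p - 1)))
    (by
      have : γ / (p - 1) < 1 + Θ := (div_lt_iff₀ hp1).2 hγ2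
      rw [mul_neg, mul_one_div]
      linarith)
    (by
      have : ν / (p - 1) < 2 + θ := (div_lt_iff₀ hp1).2 hν2
      rw [mul_neg, mul_one_div]
      linarith)
  refine ⟨C₁ * C₂ ^ (p - 1), by positivity, fun x hx r hr => ?_⟩
  have hX0 : 0 < ‖x‖ + r := by positivity
  have hY0 : 0 < rhoD κ x + r := add_pos_of_nonneg_of_pos (rhoD_nonneg κ x) hr
  have hu₁ := h₁ x hx r hr
  have hu₂ := h₂ x hx r hr
  simp only [Real.rpow_one] at hu₁
  set Z := (‖x‖ + r) ^ (ν - γ) * (rhoD κ x + r) ^ γ with hZ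
  have hZ0 : 0 < Z := by positivity
  refine (mul_le_mul' hu₁ (ENNReal.rpow_le_rpow hu₂ hp1.le)).trans_eq ?_
  rw [ENNReal.ofReal_rpow_of_pos (by positivity), ← ENNReal.ofReal_mul (by positivity)]
  congr 1
  rw [Real.mul_rpow hC₂.le (by positivity), ← Real.rpow_mul hZ0.le,
    show -(1 / (p - 1)) * (p - 1) = -1 by field_simp, Real.rpow_neg_one]
  field_simp
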